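/- Let k : Fin 3 → Fin 3 → ZMod d be a game matrix whose first row and first column are zero and whose remaining entries are w = k(1,1), x = k(1,2), y = k(2,1), z = k(2,2) (rows and columns indexed 0,1,2). Assume w, x, y, z are all nonzero and pairwise distinct. Then β_C(k) = 3 if at least one of the following holds in ZMod d: x + y = w + z, or x + y = z, or x = w + z, or x + y = w, or y = w + z; and β_C(k) = 4 (the maximal value) if none of these five conditions holds. -/

import Mathlib

/-- The number of contradictions of the classical strategy `(a, b)` for the game matrix `k`. -/
def numContr {nA nB d : ℕ} (k : Fin nA → Fin nB → ZMod d)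
    (a : Fin nA → ZMod d) (b : Fin nB → ZMod d) : ℕ :=
  ((Finset.univ : Finset (Fin nA × Fin nB)).filter
    (fun p => b p.2 ≠ a p.1 + k p.1 p.2)).card

/-- The contradiction number `β_C(k)`: the minimum number of contradictions over all
classical strategies. -/
noncomputable def betaC {nA nB d : ℕ} (k : Fin nA → Fin nB → ZMod d) : ℕ :=
  sInf { m | ∃ (a : Fin nA → ZMod d) (b : Fin nB → ZMod d), numContr k a b = m }

set_option synthInstance.maxSize 1000 in
set_option synthInstance.maxHeartbeats 400000 in
set_option maxRecDepth 20000 in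
/-- If a set of cells of the `3 × 3` board contains no rectangle, except possibly the one on the
last two rows and columns, then at least three cells are missing. -/
private lemma three_le_card_of_no_rectangle : ∀ s00 s01 s02 s10 s11 s12 s20 s21 s22 : Bool,
    ¬ (s00 ∧ s01 ∧ s10 ∧ s11) → ¬ (s00 ∧ s02 ∧ s10 ∧ s12) → ¬ (s01 ∧ s02 ∧ s11 ∧ s12) →
    ¬ (s00 ∧ s01 ∧ s20 ∧ s21) → ¬ (s00 ∧ s02 ∧ s20 ∧ s22) → ¬ (s01 ∧ s02 ∧ s21 ∧ s22) →
    ¬ (s10 ∧ s11 ∧ s20 ∧ s21) → ¬ (s10 ∧ s12 ∧ s20 ∧ s22) →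
    3 ≤ (!s00).toNat + (!s01).toNat + (!s02).toNat + (!s10).toNat + (!s11).toNat
      + (!s12).toNat + (!s20).toNat + (!s21).toNat + (!s22).toNat ∧
    (¬ (s11 ∧ s12 ∧ s21 ∧ s22) →
      ¬ (s01 ∧ s02 ∧ s10 ∧ s12 ∧ s20 ∧ s21) → ¬ (s00 ∧ s02 ∧ s11 ∧ s12 ∧ s20 ∧ s21) →
      ¬ (s00 ∧ s01 ∧ s10 ∧ s12 ∧ s21 ∧ s22) → ¬ (s01 ∧ s02 ∧ s10 ∧ s11 ∧ s20 ∧ s22) →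
      ¬ (s00 ∧ s01 ∧ s11 ∧ s12 ∧ s20 ∧ s22) → ¬ (s00 ∧ s02 ∧ s10 ∧ s11 ∧ s21 ∧ s22) →
      4 ≤ (!s00).toNat + (!s01).toNat + (!s02).toNat + (!s10).toNat + (!s11).toNat
        + (!s12).toNat + (!s20).toNat + (!s21).toNat + (!s22).toNat) := by
  decide

private lemma numContr_eq_sum {d : ℕ} (k : Fin 3 → Fin 3 → ZMod d) (a b : Fin 3 → ZMod d) :
    numContr k a b = ∑ i, ∑ j, (!decide (b j = a i + k i j)).toNat := by
  rw [numContr, Finset.card_filter, Fintype.sum_prod_type]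
  refine Finset.sum_congr rfl fun i _ => Finset.sum_congr rfl fun j _ => ?_
  by_cases h : b j = a i + k i j <;> simp [h]

private lemma betaC_le {d : ℕ} {k : Fin 3 → Fin 3 → ZMod d} {m : ℕ} (a b : Fin 3 → ZMod d)
    (h : numContr k a b ≤ m) : betaC k ≤ m :=
  le_trans (Nat.sInf_le ⟨a, b, rfl⟩) h

private lemma le_betaC {d : ℕ} {k : Fin 3 → Fin 3 → ZMod d} {m : ℕ}
    (h : ∀ a b, m ≤ numContr k a b) : m ≤ betaC k := by
  refine le_csInf ⟨_, 0, 0, rfl⟩ ?_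
  rintro _ ⟨a, b, rfl⟩
  exact h a b

/-- A strategy whose contradictions all lie in `t` bounds `betaC` by the size of `t`. -/
private lemma betaC_le_card {d : ℕ} {k : Fin 3 → Fin 3 → ZMod d} (t : Finset (Fin 3 × Fin 3))
    (a b : Fin 3 → ZMod d) (h : ∀ i j, (i, j) ∉ t → b j = a i + k i j) :
    betaC k ≤ t.card := by
  refine betaC_le a b (Finset.card_le_card fun p hp => ?_)
  by_contra hpt
  exact (Finset.mem_filter.mp hp).2 (h p.1 p.2 hpt)

/-- For a `3 × 3` game matrix with zero first row and column and remaining entries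
`w = k(1,1)`, `x = k(1,2)`, `y = k(2,1)`, `z = k(2,2)`, all nonzero and pairwise
distinct: `β_C = 3` if one of the five listed conditions holds, and `β_C = 4` (the
maximal value) otherwise. -/
theorem betaC_general_3x3 {d : ℕ} (hd : 1 ≤ d) (k : Fin 3 → Fin 3 → ZMod d)
    (w x y z : ZMod d)
    (hrow : ∀ j : Fin 3, k 0 j = 0) (hcol : ∀ i : Fin 3, k i 0 = 0)
    (h11 : k 1 1 = w) (h12 : k 1 2 = x) (h21 : k 2 1 = y) (h22 : k 2 2 = z)
    (hw : w ≠ 0) (hx : x ≠ 0) (hy : y ≠ 0) (hz : z ≠ 0)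
    (hwx : w ≠ x) (hwy : w ≠ y) (hwz : w ≠ z)
    (hxy : x ≠ y) (hxz : x ≠ z) (hyz : y ≠ z) :
    ((x + y = w + z ∨ x + y = z ∨ x = w + z ∨ x + y = w ∨ y = w + z) → betaC k = 3) ∧
    (¬ (x + y = w + z ∨ x + y = z ∨ x = w + z ∨ x + y = w ∨ y = w + z) → betaC k = 4) := by
  have h00 := hrow 0
  have h01 := hrow 1
  have h02 := hrow 2
  have h10 := hcol 1
  have h20 := hcol 2
  have key (a b : Fin 3 → ZMod d) : 3 ≤ numContr k a b ∧
      (¬ (x + y = w + z ∨ x + y = z ∨ x = w + z ∨ x + y = w ∨ y = w + z) →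
        4 ≤ numContr k a b) := by
    have H := three_le_card_of_no_rectangle
      (decide (b 0 = a 0 + k 0 0)) (decide (b 1 = a 0 + k 0 1)) (decide (b 2 = a 0 + k 0 2))
      (decide (b 0 = a 1 + k 1 0)) (decide (b 1 = a 1 + k 1 1)) (decide (b 2 = a 1 + k 1 2))
      (decide (b 0 = a 2 + k 2 0)) (decide (b 1 = a 2 + k 2 1)) (decide (b 2 = a 2 + k 2 2))
    simp only [decide_eq_true_eq, h00, h01, h02, h10, h20, h11, h12, h21, h22] at H
    simp only [numContr_eq_sum, Fin.sum_univ_three, h00, h01, h02, h10, h20, h11, h12, h21, h22,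
      ← add_assoc]
    obtain ⟨h3, h4⟩ := H (by grind) (by grind) (by grind) (by grind) (by grind) (by grind)
      (by grind) (by grind)
    exact ⟨h3, fun hn => h4 (by grind) (by grind) (by grind) (by grind) (by grind) (by grind)
      (by grind)⟩
  refine ⟨fun h => le_antisymm ?_ (le_betaC fun a b => (key a b).1),
    fun h => le_antisymm ?_ (le_betaC fun a b => (key a b).2 h)⟩
  · rcases h with h | h | h | h | h
    · refine betaC_le_card {(0, 1), (0, 2), (2, 0)} ![0, 0, w - y] ![0, w, x] ?_
      simp [Fin.forall_fin_succ, *]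
      grind
    · refine betaC_le_card {(0, 2), (1, 1), (2, 0)} ![0, 0, -y] ![0, 0, x] ?_
      simp [Fin.forall_fin_succ, *]
      grind
    · refine betaC_le_card {(0, 2), (1, 0), (2, 1)} ![0, -w, 0] ![0, 0, z] ?_
      simp [Fin.forall_fin_succ, *]
    · refine betaC_le_card {(0, 1), (1, 0), (2, 2)} ![0, -x, 0] ![0, y, 0] ?_
      simp [Fin.forall_fin_succ, *]
      grind
    · refine betaC_le_card {(0, 1), (1, 2), (2, 0)} ![0, 0, -z] ![0, w, 0] ?_
      simp [Fin.forall_fin_succ, *]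
  · refine betaC_le_card {(1, 1), (1, 2), (2, 1), (2, 2)} 0 0 ?_
    simp [Fin.forall_fin_succ, *]
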